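/- Let n ≥ 1, r₁, r₂ > 0, and b₁, b₂, b₁', b₂' ∈ ℝⁿ with the same spatial parts, b⃗₁' = b⃗₁ and b⃗₂' = b⃗₂, and with smaller time-distance between centers, |b₁'₀ − b₂'₀| ≤ |b₁₀ − b₂₀|. If the Euclidean closed balls closedBall(b₁, r₁) and closedBall(b₂, r₂) are causally disjoint, then so are closedBall(b₁', r₁) and closedBall(b₂', r₂); i.e. decreasing the time-distance between the centers of two causally disjoint balls preserves causal disjointness. -/

import Mathlib

open Set Metric unitInterval

noncomputable section

/-- `n`-dimensional Minkowski space, modeled as `ℝⁿ` with the Euclidean norm. -/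
abbrev Mink (n : ℕ) := EuclideanSpace ℝ (Fin n)

/-- The spatial part `x⃗ = (x 1, …, x (n-1)) ∈ ℝ^{n-1}` of `x ∈ ℝⁿ`. -/
def spatial {n : ℕ} (x : Mink n) : Mink (n - 1) :=
  (WithLp.equiv 2 _).symm fun i : Fin (n - 1) => x ⟨i.1 + 1, by have := i.isLt; omega⟩

/-- A curve `γ` is future-directed causal if it is `C¹` and
`(γ₀)'(t) ≥ ‖(γ⃗)'(t)‖` for all `t ∈ [0,1]`. -/
def FDCausal {n : ℕ} [NeZero n] (γ : ℝ → Mink n) : Prop :=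
  ContDiff ℝ 1 γ ∧
    ∀ t ∈ Set.Icc (0 : ℝ) 1,
      ‖deriv (fun s => spatial (γ s)) t‖ ≤ deriv (fun s => γ s 0) t

/-- A curve `γ` is past-directed causal if it is `C¹` and
`-(γ₀)'(t) ≥ ‖(γ⃗)'(t)‖` for all `t ∈ [0,1]`. -/
def PDCausal {n : ℕ} [NeZero n] (γ : ℝ → Mink n) : Prop :=
  ContDiff ℝ 1 γ ∧
    ∀ t ∈ Set.Icc (0 : ℝ) 1,
      ‖deriv (fun s => spatial (γ s)) t‖ ≤ -(deriv (fun s => γ s 0) t)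

/-- A causal curve is a future- or past-directed causal curve. -/
def IsCausalCurve {n : ℕ} [NeZero n] (γ : ℝ → Mink n) : Prop :=
  FDCausal γ ∨ PDCausal γ

/-- `S` and `T` are causally disjoint if no causal curve starts in `S` and ends in `T`. -/
def CausallyDisjoint {n : ℕ} [NeZero n] (S T : Set (Mink n)) : Prop :=
  ¬ ∃ γ : ℝ → Mink n, IsCausalCurve γ ∧ γ 0 ∈ S ∧ γ 1 ∈ T

/-- The spatial part as a continuous linear map. -/
def spatialCLM (n : ℕ) : Mink n →L[ℝ] Mink (n - 1) :=
  LinearMap.toContinuousLinearMap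
    { toFun := spatial
      map_add' := fun x y => by ext i; simp [spatial]
      map_smul' := fun c x => by ext i; simp [spatial] }

theorem spatialCLM_apply {n : ℕ} (x : Mink n) : spatialCLM n x = spatial x := rfl

theorem FDCausal.norm_spatial_sub_le {n : ℕ} [NeZero n] {γ : ℝ → Mink n} (h : FDCausal γ) :
    ‖spatial (γ 1) - spatial (γ 0)‖ ≤ γ 1 0 - γ 0 0 := by
  obtain ⟨hγ, hd⟩ := h
  have hγd : Differentiable ℝ γ := hγ.differentiable (by norm_num)
  have hs : Differentiable ℝ fun s => spatial (γ s) :=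
    (spatialCLM n).differentiable.comp hγd
  have ht : Differentiable ℝ fun s => γ s 0 :=
    (EuclideanSpace.proj (𝕜 := ℝ) (0 : Fin n)).differentiable.comp hγd
  refine image_norm_le_of_norm_deriv_right_le_deriv_boundary
    (f := fun t => spatial (γ t) - spatial (γ 0)) (a := 0) (b := 1)
    (B := fun t => γ t 0 - γ 0 0)
    (hs.continuous.sub continuous_const).continuousOn
    (fun t _ => ((hs t).hasDerivAt.sub_const _).hasDerivWithinAt)
    (by simp) (fun t => (ht t).hasDerivAt.sub_const _)
    (fun t ht => hd t ⟨ht.1, ht.2.le⟩) (x := 1) (by simp)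

theorem PDCausal.reverse {n : ℕ} [NeZero n] {γ : ℝ → Mink n} (h : PDCausal γ) :
    FDCausal fun t => γ (1 - t) := by
  obtain ⟨hγ, hd⟩ := h
  refine ⟨hγ.comp (contDiff_const.sub contDiff_id), fun t ht => ?_⟩
  rw [deriv_comp_const_sub (f := fun s => spatial (γ s)),
    deriv_comp_const_sub (f := fun s => γ s 0), norm_neg]
  exact hd (1 - t) ⟨by linarith [ht.2], by linarith [ht.1]⟩

theorem IsCausalCurve.norm_spatial_sub_le {n : ℕ} [NeZero n] {γ : ℝ → Mink n}
    (h : IsCausalCurve γ) : ‖spatial (γ 1) - spatial (γ 0)‖ ≤ |γ 1 0 - γ 0 0| := by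
  rcases h with h | h
  · exact h.norm_spatial_sub_le.trans (le_abs_self _)
  · have h' := h.reverse.norm_spatial_sub_le
    simp only [sub_self, sub_zero] at h'
    rw [norm_sub_rev, abs_sub_comm]
    exact h'.trans (le_abs_self _)

/-- The straight segment between causally related points is a causal curve. -/
theorem isCausalCurve_segment {n : ℕ} [NeZero n] {x y : Mink n}
    (h : ‖spatial y - spatial x‖ ≤ |y 0 - x 0|) :
    IsCausalCurve fun t : ℝ => x + t • (y - x) := by
  have hγ : ∀ t : ℝ, HasDerivAt (fun t : ℝ => x + t • (y - x)) (y - x) t := fun t => by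
    simpa using ((hasDerivAt_id t).smul_const (y - x)).const_add x
  have hs : ∀ t : ℝ, deriv (fun s : ℝ => spatial (x + s • (y - x))) t = spatial y - spatial x :=
    fun t => by
      rw [← spatialCLM_apply, ← spatialCLM_apply, ← map_sub]
      exact ((spatialCLM n).hasFDerivAt.comp_hasDerivAt t (hγ t)).deriv
  have ht : ∀ t : ℝ, deriv (fun s : ℝ => (x + s • (y - x)) 0) t = y 0 - x 0 := fun t =>
    ((EuclideanSpace.proj (𝕜 := ℝ) (0 : Fin n)).hasFDerivAt.comp_hasDerivAt t (hγ t)).deriv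
  have hc : ContDiff ℝ 1 fun t : ℝ => x + t • (y - x) := by fun_prop
  rcases le_abs.mp h with h | h
  · exact Or.inl ⟨hc, fun t _ => by rw [hs, ht]; exact h⟩
  · exact Or.inr ⟨hc, fun t _ => by rw [hs, ht]; exact h⟩

/-- Two sets are causally disjoint iff all pairs of their points are spacelike separated. -/
theorem causallyDisjoint_iff {n : ℕ} [NeZero n] {S T : Set (Mink n)} :
    CausallyDisjoint S T ↔ ∀ x ∈ S, ∀ y ∈ T, |y 0 - x 0| < ‖spatial y - spatial x‖ := by
  constructor
  · intro h x hx y hy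
    by_contra! hxy
    exact h ⟨_, isCausalCurve_segment hxy, by simpa using hx, by simpa using hy⟩
  · rintro h ⟨γ, hγ, h0, h1⟩
    exact (h _ h0 _ h1).not_ge hγ.norm_spatial_sub_le

theorem spatial_apply_eq {n : ℕ} [NeZero n] {x y : Mink n} (h : spatial x = spatial y)
    {i : Fin n} (hi : i ≠ 0) : x i = y i := by
  have hi' : i.1 ≠ 0 := fun h0 => hi (Fin.ext (by simpa using h0))
  have := congrArg (fun z : Mink (n - 1) => z ⟨i.1 - 1, by omega⟩) h
  simpa [spatial, Nat.sub_add_cancel (Nat.one_le_iff_ne_zero.mpr hi')] using this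

/-- Translating a ball in time, its points can be moved along so that their spatial part is
preserved and their time offset from the center changes at most by a sign. -/
theorem exists_mem_closedBall_of_spatial_eq {n : ℕ} [NeZero n] {b b' x : Mink n} {r a : ℝ}
    (hb : spatial b' = spatial b) (hx : x ∈ closedBall b' r) (ha : |a| = |x 0 - b' 0|) :
    ∃ z ∈ closedBall b r, spatial z = spatial x ∧ z 0 = b 0 + a := by
  refine ⟨WithLp.toLp 2 (Function.update x 0 (b 0 + a)), ?_, ?_, by simp⟩
  · rw [mem_closedBall] at hx ⊢
    refine le_of_eq_of_le ?_ hx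
    rw [EuclideanSpace.dist_eq, EuclideanSpace.dist_eq]
    congr 1
    refine Finset.sum_congr rfl fun i _ => ?_
    by_cases hi : i = 0
    · subst hi
      simpa [Real.dist_eq] using (sq_eq_sq_iff_abs_eq_abs _ _).mpr ha
    · simp [Function.update_of_ne hi, spatial_apply_eq hb hi]
  · ext i
    simp [spatial]

/-- Decreasing the time-distance between the centers of two causally disjoint balls
(keeping the spatial parts fixed) preserves causal disjointness. -/
theorem causallyDisjoint_balls_of_time_shrink (n : ℕ) [NeZero n] (hn : 1 ≤ n)
    (r₁ r₂ : ℝ) (hr₁ : 0 < r₁) (hr₂ : 0 < r₂)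
    (b₁ b₂ b₁' b₂' : Mink n)
    (hsp₁ : spatial b₁' = spatial b₁) (hsp₂ : spatial b₂' = spatial b₂)
    (htime : |b₁' 0 - b₂' 0| ≤ |b₁ 0 - b₂ 0|)
    (h : CausallyDisjoint (closedBall b₁ r₁) (closedBall b₂ r₂)) :
    CausallyDisjoint (closedBall b₁' r₁) (closedBall b₂' r₂) := by
  rw [causallyDisjoint_iff] at h ⊢
  intro x hx y hy
  obtain ⟨s, hs, hsΔ⟩ : ∃ s : ℝ, |s| = 1 ∧ b₂ 0 - b₁ 0 = s * |b₁ 0 - b₂ 0| := by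
    rcases abs_cases (b₁ 0 - b₂ 0) with ⟨h, _⟩ | ⟨h, _⟩
    · exact ⟨-1, by simp, by rw [h]; ring⟩
    · exact ⟨1, by simp, by rw [h]; ring⟩
  obtain ⟨z, hz, hzs, hz0⟩ := exists_mem_closedBall_of_spatial_eq
    (a := -(s * |x 0 - b₁' 0|)) hsp₁ hx (by simp [abs_mul, hs])
  obtain ⟨w, hw, hws, hw0⟩ := exists_mem_closedBall_of_spatial_eq
    (a := s * |y 0 - b₂' 0|) hsp₂ hy (by simp [abs_mul, hs])
  have hzw := h z hz w hw
  rw [hzs, hws] at hzw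
  refine lt_of_le_of_lt ?_ hzw
  have hwz : w 0 - z 0 = s * (|b₁ 0 - b₂ 0| + |x 0 - b₁' 0| + |y 0 - b₂' 0|) := by
    rw [hw0, hz0]
    linear_combination hsΔ
  have hΔ : 0 ≤ |b₁ 0 - b₂ 0| + |x 0 - b₁' 0| + |y 0 - b₂' 0| := by positivity
  rw [hwz, abs_mul, hs, one_mul, abs_of_nonneg hΔ]
  calc |y 0 - x 0| = |(y 0 - b₂' 0) - (x 0 - b₁' 0) - (b₁' 0 - b₂' 0)| := by ring_nf
    _ ≤ |y 0 - b₂' 0| + |x 0 - b₁' 0| + |b₁' 0 - b₂' 0| :=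
      (abs_sub _ _).trans (add_le_add_left (abs_sub _ _) _)
    _ ≤ _ := by linarith
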